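/- arXiv:2602.11331 — 5 statements merged into one kernel-verified Lean document; each statement's English description precedes it below -/
import Mathlib

section
/- For all positive integers r, p, q, the graph G(r,p,q) = K_1 ⊕ (p K_r ∪ q(K_1 ⊕ (K_1 ∪ K_2))) has second largest distance eigenvalue λ2(G(r,p,q)) < −1/2. -/
open Polynomial SimpleGraph Sum

noncomputable section

/-- The distance matrix of a graph, with real entries. -/
def distMatrix {V : Type*} [Fintype V] (G : SimpleGraph V) : Matrix V V ℝ :=
  Matrix.of fun u v => (G.dist u v : ℝ)

/-- The second largest distance eigenvalue: the eigenvalues of the distance matrix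
(the roots of its characteristic polynomial, with multiplicity) are sorted in
increasing order, and we take the one at position `card V - 2`. -/
def lambda2 {V : Type*} [Fintype V] [DecidableEq V] (G : SimpleGraph V) : ℝ :=
  ((distMatrix G).charpoly.roots.sort (· ≤ ·)).getD (Fintype.card V - 2) 0

/-- The diameter of a finite graph. -/
def graphDiam {V : Type*} [Fintype V] (G : SimpleGraph V) : ℕ :=
  Finset.univ.sup fun p : V × V => G.dist p.1 p.2

/-- A graph is chordal if every cycle of length at least 4 has a chord. -/
def IsChordal {V : Type*} (G : SimpleGraph V) : Prop :=
  ∀ (v : V) (c : G.Walk v v), c.IsCycle → 4 ≤ c.length →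
    ∃ u w : V, u ∈ c.support ∧ w ∈ c.support ∧ G.Adj u w ∧ s(u, w) ∉ c.edges

/-- Ptolemaic graph: the Ptolemy inequality for the graph distance. -/
def IsPtolemaic {V : Type*} (G : SimpleGraph V) : Prop :=
  ∀ u v w x : V,
    G.dist u v * G.dist w x ≤ G.dist u w * G.dist v x + G.dist u x * G.dist v w

/-- `S` is a `uv`-separator: `u, v ∉ S` and every walk from `u` to `v` meets `S`. -/
def IsUVSeparator {V : Type*} (G : SimpleGraph V) (S : Finset V) (u v : V) : Prop :=
  u ∉ S ∧ v ∉ S ∧ ∀ w : G.Walk u v, ∃ x ∈ w.support, x ∈ S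

/-- `S` is a minimal vertex separator: a minimal `uv`-separator for some pair of
distinct non-adjacent vertices `u, v`. -/
def IsMinimalVertexSeparator {V : Type*} (G : SimpleGraph V) (S : Finset V) : Prop :=
  ∃ u v : V, u ≠ v ∧ ¬ G.Adj u v ∧ IsUVSeparator G S u v ∧
    ∀ T : Finset V, T ⊂ S → ¬ IsUVSeparator G T u v

/-- A connected component `K` of `G − S` is full if every vertex of `S` has a
neighbour in `K`. -/
def IsFullComponent {V : Type*} (G : SimpleGraph V) (S : Finset V)
    (K : (G.induce ((S : Set V)ᶜ)).ConnectedComponent) : Prop :=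
  ∀ a ∈ S, ∃ x : ((S : Set V)ᶜ : Set V),
    (G.induce ((S : Set V)ᶜ)).connectedComponentMk x = K ∧ G.Adj a ↑x

/-- The join `G ⊕ H` of two vertex-disjoint graphs. -/
def graphJoin {α β : Type*} (G : SimpleGraph α) (H : SimpleGraph β) :
    SimpleGraph (α ⊕ β) :=
  SimpleGraph.fromRel fun x y =>
    (∃ a b, x = Sum.inl a ∧ y = Sum.inl b ∧ G.Adj a b) ∨
    (∃ a b, x = Sum.inr a ∧ y = Sum.inr b ∧ H.Adj a b) ∨
    (x.isLeft ∧ y.isRight)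

/-- The disjoint union of two vertex-disjoint graphs. -/
def graphSum {α β : Type*} (G : SimpleGraph α) (H : SimpleGraph β) :
    SimpleGraph (α ⊕ β) :=
  SimpleGraph.fromRel fun x y =>
    (∃ a b, x = Sum.inl a ∧ y = Sum.inl b ∧ G.Adj a b) ∨
    (∃ a b, x = Sum.inr a ∧ y = Sum.inr b ∧ H.Adj a b)

/-- `p` disjoint copies of the complete graph `K_r`. -/
def cliqueCopies (p r : ℕ) : SimpleGraph (Fin p × Fin r) :=
  SimpleGraph.fromRel fun x y => x.1 = y.1

/-- `q` disjoint copies of `K_1 ⊕ (K_1 ∪ K_2)` (the paw graph): in each copy,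
vertex 0 is universal, vertex 1 is otherwise isolated, vertices 2,3 form a `K_2`. -/
def pawCopies (q : ℕ) : SimpleGraph (Fin q × Fin 4) :=
  SimpleGraph.fromRel fun x y => x.1 = y.1 ∧ (x.2 = 0 ∨ (x.2 = 2 ∧ y.2 = 3))

/-- `s` disjoint copies of the path `P_3`. -/
def path3Copies (s : ℕ) : SimpleGraph (Fin s × Fin 3) :=
  SimpleGraph.fromRel fun x y => x.1 = y.1 ∧ ((x.2 = 0 ∧ y.2 = 1) ∨ (x.2 = 1 ∧ y.2 = 2))

/-- The disjoint union `p_1 K_{r_1} ∪ ⋯ ∪ p_k K_{r_k}`. -/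
def multiCliques (k : ℕ) (p r : Fin k → ℕ) :
    SimpleGraph ((i : Fin k) × (Fin (p i) × Fin (r i))) :=
  SimpleGraph.fromRel fun x y =>
    (⟨x.1, x.2.1⟩ : (i : Fin k) × Fin (p i)) = ⟨y.1, y.2.1⟩

/-- The relaxed block star
`K_1 ⊕ ((p_1 K_{r_1} ∪ ⋯ ∪ p_k K_{r_k}) ∪ q (K_1 ⊕ (K_1 ∪ K_2)) ∪ s P_3)`. -/
def relaxedBlockStar (k : ℕ) (p r : Fin k → ℕ) (q s : ℕ) :
    SimpleGraph (Unit ⊕ (((i : Fin k) × (Fin (p i) × Fin (r i))) ⊕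
      ((Fin q × Fin 4) ⊕ (Fin s × Fin 3)))) :=
  graphJoin (⊤ : SimpleGraph Unit)
    (graphSum (multiCliques k p r) (graphSum (pawCopies q) (path3Copies s)))

/-- The graph `G(r,p,q) = K_1 ⊕ (p K_r ∪ q (K_1 ⊕ (K_1 ∪ K_2)))`. -/
def Grpq (r p q : ℕ) : SimpleGraph (Unit ⊕ ((Fin p × Fin r) ⊕ (Fin q × Fin 4))) :=
  graphJoin (⊤ : SimpleGraph Unit) (graphSum (cliqueCopies p r) (pawCopies q))

/-- The full house graph `K_2 ⊕ (K_1 ∪ K_2)`: vertices 0,1 form the join-`K_2`,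
vertex 2 is the `K_1`, vertices 3,4 form the `K_2`. -/
def fullHouse : SimpleGraph (Fin 5) :=
  SimpleGraph.fromRel fun x y => x = 0 ∨ x = 1 ∨ (x = 3 ∧ y = 4)

/-- The diamond graph: `K_4` minus an edge. -/
def diamondGraph : SimpleGraph (Fin 4) :=
  SimpleGraph.fromRel fun x y => x = 0 ∨ x = 1

/-- The path on four vertices. -/
def path4 : SimpleGraph (Fin 4) :=
  SimpleGraph.fromRel fun x y => (x : ℕ) + 1 = (y : ℕ)

/-- The cycle on four vertices. -/
def cycle4 : SimpleGraph (Fin 4) :=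
  SimpleGraph.fromRel fun x y => x + 1 = y

/-- The triple block graph `Pt_2(p,q)`: a full house (on `Fin 5`, with the
join-`K_2` being vertices `a = 0`, `b = 1`) together with `p - 1` further vertices
forming with `a` a clique `K_p` and `q - 1` further vertices forming with `b`
a clique `K_q`. -/
def Pt2Graph (p q : ℕ) : SimpleGraph (Fin 5 ⊕ (Fin (p - 1) ⊕ Fin (q - 1))) :=
  SimpleGraph.fromRel fun x y =>
    match x, y with
    | Sum.inl a, Sum.inl b => a = 0 ∨ a = 1 ∨ (a = 3 ∧ b = 4)
    | Sum.inl a, Sum.inr (Sum.inl _) => a = 0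
    | Sum.inl a, Sum.inr (Sum.inr _) => a = 1
    | Sum.inr (Sum.inl _), Sum.inr (Sum.inl _) => True
    | Sum.inr (Sum.inr _), Sum.inr (Sum.inr _) => True
    | _, _ => False

/-- The nine-vertex graph `Pt_1`: a full house (vertices 0,…,4, join-`K_2` being
`a = 0`, `b = 1`, `K_2` being 3,4), a vertex 5 adjacent only to `a`, a vertex 6
adjacent only to `b`, and vertices 7,8 adjacent to each other and to `b`. -/
def Pt1Graph : SimpleGraph (Fin 9) :=
  SimpleGraph.fromRel fun x y =>
    (x = 0 ∧ (y = 1 ∨ y = 2 ∨ y = 3 ∨ y = 4 ∨ y = 5)) ∨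
    (x = 1 ∧ (y = 2 ∨ y = 3 ∨ y = 4 ∨ y = 6 ∨ y = 7 ∨ y = 8)) ∨
    (x = 3 ∧ y = 4) ∨ (x = 7 ∧ y = 8)

/-- `G` contains an induced subgraph isomorphic to `H`. -/
def HasInducedSubgraph {V W : Type*} (G : SimpleGraph V) (H : SimpleGraph W) : Prop :=
  ∃ s : Set V, Nonempty ((G.induce s) ≃g H)

/-- `G` is isomorphic to a connected induced subgraph of `H`. -/
def IsoToConnectedInducedSubgraph {V W : Type*} (G : SimpleGraph V)
    (H : SimpleGraph W) : Prop :=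
  ∃ s : Set W, (H.induce s).Connected ∧ Nonempty (G ≃g (H.induce s))

/-- A vertex is simplicial if its neighbourhood is a clique. -/
def IsSimplicial {V : Type*} (G : SimpleGraph V) (v : V) : Prop :=
  G.IsClique (G.neighborSet v)

/-- The quintic polynomial `f(r,p,q,x)`. -/
def fpoly (r p q : ℕ) : Polynomial ℝ :=
  X ^ 5 - C (8 * (q : ℝ) + 2 * (r : ℝ) * (p : ℝ) - (r : ℝ) - 8) * X ^ 4
    - C ((8 * (r : ℝ) + 36) * (q : ℝ) + 15 * (r : ℝ) * (p : ℝ) - 7 * (r : ℝ) - 20) * X ^ 3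
    - C ((28 * (r : ℝ) + 52) * (q : ℝ) + 33 * (r : ℝ) * (p : ℝ) - 13 * (r : ℝ) - 18) * X ^ 2
    - C ((24 * (r : ℝ) + 30) * (q : ℝ) + 23 * (r : ℝ) * (p : ℝ) - 5 * (r : ℝ) - 5) * X
    - C ((6 * (r : ℝ) + 6) * (q : ℝ) + 5 * (r : ℝ) * (p : ℝ))

end

open Matrix in
/-- If a real symmetric matrix is smaller than `μ` as a quadratic form on the hyperplane
orthogonal to `w`, then its second largest eigenvalue is less than `μ`. -/
theorem second_eigenvalue_lt_of_forall_orthogonal {V : Type*} [Fintype V] [DecidableEq V]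
    {A : Matrix V V ℝ} (hA : A.IsHermitian) (hV : 2 ≤ Fintype.card V) (μ : ℝ) (w : V → ℝ)
    (h : ∀ x : V → ℝ, x ≠ 0 → w ⬝ᵥ x = 0 → x ⬝ᵥ (A *ᵥ x) < μ * (x ⬝ᵥ x)) :
    (A.charpoly.roots.sort (· ≤ ·)).getD (Fintype.card V - 2) 0 < μ := by
  have hsort : A.charpoly.roots.sort (· ≤ ·) = (List.ofFn hA.eigenvalues₀).reverse := by
    rw [← hA.sort_roots_charpoly_eq_eigenvalues₀]
    refine List.Perm.eq_of_pairwise (le := (· ≤ ·)) (fun a b _ _ => le_antisymm)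
      (Multiset.pairwise_sort _ _) ?_ ?_
    · rw [List.pairwise_reverse]
      exact Multiset.pairwise_sort _ _
    · rw [← Multiset.coe_eq_coe]
      simp [Multiset.sort_eq]
  have hval : (A.charpoly.roots.sort (· ≤ ·)).getD (Fintype.card V - 2) 0
      = hA.eigenvalues₀ ⟨1, by omega⟩ := by
    rw [hsort, List.getD_eq_getElem _ _ (by simp; omega), List.getElem_reverse]
    simp only [List.getElem_ofFn, List.length_ofFn]
    congr 2
    omega
  rw [hval]
  by_contra! hμ
  let e := Fintype.equivOfCardEq (Fintype.card_fin (Fintype.card V))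
  let i : V := e ⟨0, by omega⟩
  let j : V := e ⟨1, by omega⟩
  have hij : i ≠ j := fun hc => by simpa using congrArg Fin.val (e.injective hc)
  have hj : μ ≤ hA.eigenvalues j := by simpa [IsHermitian.eigenvalues, j, e] using hμ
  have hi : μ ≤ hA.eigenvalues i := by
    refine hj.trans ?_
    simp only [IsHermitian.eigenvalues, i, j, e, Equiv.symm_apply_apply]
    exact hA.eigenvalues₀_antitone (by simp)
  set b := hA.eigenvectorBasis
  have hdot : ∀ k l, (b k : V → ℝ) ⬝ᵥ (b l : V → ℝ) = if k = l then 1 else 0 := by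
    intro k l
    have := orthonormal_iff_ite.mp b.orthonormal l k
    rw [EuclideanSpace.inner_eq_star_dotProduct] at this
    simpa [eq_comm] using this
  obtain ⟨α, β, hαβ, hw⟩ : ∃ α β : ℝ, 0 < α * α + β * β ∧
      α * (w ⬝ᵥ (b i : V → ℝ)) + β * (w ⬝ᵥ (b j : V → ℝ)) = 0 := by
    by_cases h0 : w ⬝ᵥ (b i : V → ℝ) = 0
    · exact ⟨1, 0, by norm_num, by simp [h0]⟩
    · exact ⟨-(w ⬝ᵥ (b j : V → ℝ)), w ⬝ᵥ (b i : V → ℝ),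
        add_pos_of_nonneg_of_pos (mul_self_nonneg _) (mul_self_pos.mpr h0), by ring⟩
  set x : V → ℝ := α • (b i : V → ℝ) + β • (b j : V → ℝ) with hx
  have hxx : x ⬝ᵥ x = α * α + β * β := by
    simp [hx, hdot, hij, hij.symm]
  have hAx : A *ᵥ x = (α * hA.eigenvalues i) • (b i : V → ℝ)
      + (β * hA.eigenvalues j) • (b j : V → ℝ) := by
    rw [hx, mulVec_add, mulVec_smul, mulVec_smul, hA.mulVec_eigenvectorBasis,
      hA.mulVec_eigenvectorBasis, smul_smul, smul_smul]
  have hxA : x ⬝ᵥ (A *ᵥ x) = α * α * hA.eigenvalues i + β * β * hA.eigenvalues j := by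
    rw [hAx, hx]
    simp [hdot, hij, hij.symm]
    ring
  have hx0 : x ≠ 0 := by
    intro h0
    rw [h0] at hxx
    simp at hxx
    linarith
  have := h x hx0 (by simpa [hx] using hw)
  rw [hxA, hxx] at this
  nlinarith [mul_le_mul_of_nonneg_left hi (mul_self_nonneg α),
    mul_le_mul_of_nonneg_left hj (mul_self_nonneg β)]

/-- In a graph with a universal vertex all distances are at most two. -/
theorem dist_eq_ite_of_universal {V : Type*} [DecidableEq V] (G : SimpleGraph V)
    [DecidableRel G.Adj] (c : V) (hc : ∀ v, v ≠ c → G.Adj c v) (u v : V) :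
    G.dist u v = if u = v then 0 else if G.Adj u v then 1 else 2 := by
  split_ifs with h1 h2
  · simp [h1]
  · exact dist_eq_one_iff_adj.mpr h2
  · have huc : u ≠ c := by
      rintro rfl
      exact h2 (hc v (Ne.symm h1))
    have hvc : v ≠ c := by
      rintro rfl
      exact h2 (hc u h1).symm
    let p : G.Walk u v := .cons (hc u huc).symm (.cons (hc v hvc) .nil)
    have hle : G.dist u v ≤ 2 := dist_le p
    have := p.reachable.one_lt_dist_of_ne_of_not_adj h1 h2
    omega

theorem distMatrix_isHermitian {V : Type*} [Fintype V] (G : SimpleGraph V) :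
    (distMatrix G).IsHermitian := by
  ext u v
  simp [distMatrix, dist_comm]

section Grpq

variable {r p q : ℕ}

theorem Grpq_adj_center (v : (Fin p × Fin r) ⊕ (Fin q × Fin 4)) :
    (Grpq r p q).Adj (inl ()) (inr v) := by
  simp [Grpq, graphJoin]

theorem Grpq_adj_clique (a b : Fin p × Fin r) :
    (Grpq r p q).Adj (inr (inl a)) (inr (inl b)) ↔ a ≠ b ∧ a.1 = b.1 := by
  simp [Grpq, graphJoin, graphSum, cliqueCopies]
  grind

theorem not_Grpq_adj_clique_paw (a : Fin p × Fin r) (b : Fin q × Fin 4) :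
    ¬ (Grpq r p q).Adj (inr (inl a)) (inr (inr b)) := by
  simp [Grpq, graphJoin, graphSum]

theorem Grpq_adj_paw (a b : Fin q × Fin 4) :
    (Grpq r p q).Adj (inr (inr a)) (inr (inr b)) ↔
      a ≠ b ∧ a.1 = b.1 ∧ (a.2 = 0 ∨ b.2 = 0 ∨ (a.2 = 2 ∧ b.2 = 3) ∨ (a.2 = 3 ∧ b.2 = 2)) := by
  simp [Grpq, graphJoin, graphSum, pawCopies, -Prod.exists]
  grind

open Classical in
theorem Grpq_dist (u v : Unit ⊕ ((Fin p × Fin r) ⊕ (Fin q × Fin 4))) :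
    (Grpq r p q).dist u v = if u = v then 0 else if (Grpq r p q).Adj u v then 1 else 2 := by
  convert dist_eq_ite_of_universal (Grpq r p q) (inl ()) ?_ u v
  rintro (_ | v) hv
  · exact absurd rfl hv
  · exact Grpq_adj_center v

theorem distMatrix_Grpq_center (v : (Fin p × Fin r) ⊕ (Fin q × Fin 4)) :
    distMatrix (Grpq r p q) (inl ()) (inr v) = 1 := by
  simp [distMatrix, Grpq_dist, Grpq_adj_center]

theorem distMatrix_Grpq_clique (a b : Fin p × Fin r) :
    distMatrix (Grpq r p q) (inr (inl a)) (inr (inl b)) =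
      2 - (if a.1 = b.1 then 1 else 0) - (if a.1 = b.1 then if a.2 = b.2 then 1 else 0 else 0) := by
  simp only [distMatrix, Matrix.of_apply, Grpq_dist, Grpq_adj_clique]
  rcases a with ⟨a, a'⟩
  rcases b with ⟨b, b'⟩
  by_cases h : a = b <;> by_cases h' : a' = b' <;> simp [h, h'] <;> norm_num

theorem distMatrix_Grpq_clique_paw (a : Fin p × Fin r) (b : Fin q × Fin 4) :
    distMatrix (Grpq r p q) (inr (inl a)) (inr (inr b)) = 2 := by
  simp [distMatrix, Grpq_dist, not_Grpq_adj_clique_paw]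

theorem distMatrix_Grpq_paw (a b : Fin q × Fin 4) :
    distMatrix (Grpq r p q) (inr (inr a)) (inr (inr b)) =
      2 - (if a.1 = b.1 then
        (!![2, 1, 1, 1; 1, 2, 0, 0; 1, 0, 2, 1; 1, 0, 1, 2] : Matrix _ _ ℝ) a.2 b.2 else 0) := by
  simp only [distMatrix, Matrix.of_apply, Grpq_dist, Grpq_adj_paw]
  rcases a with ⟨a, a'⟩
  rcases b with ⟨b, b'⟩
  by_cases h : a = b
  · fin_cases a' <;> fin_cases b' <;> simp [h] <;> norm_num
  · simp [h]

open Matrix in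
/-- The quadratic form of the distance matrix of `G(r,p,q)`, block by block. -/
theorem dotProduct_distMatrix_Grpq_mulVec (z : ℝ) (y : Fin p × Fin r → ℝ)
    (w : Fin q × Fin 4 → ℝ) :
    Sum.elim (fun _ : Unit => z) (Sum.elim y w) ⬝ᵥ
        (distMatrix (Grpq r p q) *ᵥ Sum.elim (fun _ : Unit => z) (Sum.elim y w)) =
      2 * (z + (∑ a, y a + ∑ b, w b)) * (∑ a, y a + ∑ b, w b)
        - ∑ i, ((∑ j, y (i, j)) ^ 2 + ∑ j, y (i, j) ^ 2)
        - ∑ k, (2 * (w (k, 0) ^ 2 + w (k, 1) ^ 2 + w (k, 2) ^ 2 + w (k, 3) ^ 2)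
          + 2 * (w (k, 0) * (w (k, 1) + w (k, 2) + w (k, 3)) + w (k, 2) * w (k, 3))) := by
  have hsymm : ∀ u v, distMatrix (Grpq r p q) u v = distMatrix (Grpq r p q) v u := fun u v => by
    simp [distMatrix, dist_comm]
  have hclique : ∀ a : Fin p × Fin r,
      ∑ b, distMatrix (Grpq r p q) (inr (inl a)) (inr (inl b)) * y b =
        2 * ∑ b, y b - ∑ j, y (a.1, j) - y a := by
    rintro ⟨i, j⟩
    simp only [distMatrix_Grpq_clique, sub_mul, Finset.sum_sub_distrib, ← Finset.mul_sum]
    simp only [Fintype.sum_prod_type]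
    rw [Finset.sum_comm (f := fun k l => (if i = k then 1 else 0) * y (k, l))]
    simp
  have hpaw : ∀ a : Fin q × Fin 4,
      ∑ b, distMatrix (Grpq r p q) (inr (inr a)) (inr (inr b)) * w b =
        2 * ∑ b, w b - ∑ m,
          (!![2, 1, 1, 1; 1, 2, 0, 0; 1, 0, 2, 1; 1, 0, 1, 2] : Matrix _ _ ℝ) a.2 m * w (a.1, m) := by
    rintro ⟨i, j⟩
    simp only [distMatrix_Grpq_paw, sub_mul, Finset.sum_sub_distrib, ← Finset.mul_sum]
    simp [Fintype.sum_prod_type]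
  have hcenter : distMatrix (Grpq r p q) (inl ()) (inl ()) = 0 := by simp [distMatrix]
  simp only [dotProduct, mulVec, Fintype.sum_sum_type, Sum.elim_inl, Sum.elim_inr, hclique, hpaw,
    Finset.univ_unique, Finset.sum_singleton, PUnit.default_eq_unit, hcenter,
    distMatrix_Grpq_center, distMatrix_Grpq_clique_paw, hsymm (inr _) (inl ()),
    hsymm (inr (inr _)) (inr (inl _)), ← Finset.mul_sum]
  set s := ∑ a, y a with hs
  set t := ∑ b, w b with ht
  have h1 : ∑ a : Fin p × Fin r, y a * ∑ j, y (a.1, j) = ∑ i, (∑ j, y (i, j)) ^ 2 := by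
    simp [Fintype.sum_prod_type, ← Finset.sum_mul, sq]
  have h2 : ∑ a, y a * y a = ∑ i, ∑ j, y (i, j) ^ 2 := by
    simp [Fintype.sum_prod_type, sq]
  have h3 : ∑ a : Fin q × Fin 4, w a * ∑ m,
        (!![2, 1, 1, 1; 1, 2, 0, 0; 1, 0, 2, 1; 1, 0, 1, 2] : Matrix _ _ ℝ) a.2 m * w (a.1, m) =
      ∑ k, (2 * (w (k, 0) ^ 2 + w (k, 1) ^ 2 + w (k, 2) ^ 2 + w (k, 3) ^ 2)
          + 2 * (w (k, 0) * (w (k, 1) + w (k, 2) + w (k, 3)) + w (k, 2) * w (k, 3))) := by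
    rw [Fintype.sum_prod_type]
    refine Finset.sum_congr rfl fun k _ => ?_
    simp [Fin.sum_univ_four]
    ring
  simp only [mul_add, mul_sub, Finset.sum_add_distrib, Finset.sum_sub_distrib, h1, h2, h3,
    ← Finset.sum_mul]
  ring

/-- The quadratic form of the paw shifted by `3 / 2` is positive definite. -/
theorem paw_form_lower_bound (a b c d : ℝ) :
    (1 / 100) * (a ^ 2 + b ^ 2 + c ^ 2 + d ^ 2) ≤
      (3 / 2) * (a ^ 2 + b ^ 2 + c ^ 2 + d ^ 2) + 2 * (a * (b + c + d) + c * d) := by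
  nlinarith [sq_nonneg (b + 100 / 149 * a), sq_nonneg (c + d + 200 / 249 * a), sq_nonneg (c - d),
    sq_nonneg a]

end Grpq

/-- For all positive integers `r, p, q`, the graph
`G(r,p,q) = K_1 ⊕ (p K_r ∪ q (K_1 ⊕ (K_1 ∪ K_2)))` satisfies `λ₂ < -1/2`. -/
theorem stmt_8 (r p q : ℕ) (hr : 0 < r) (hp : 0 < p) (hq : 0 < q) :
    lambda2 (Grpq r p q) < -1/2 := by
  refine second_eigenvalue_lt_of_forall_orthogonal (distMatrix_isHermitian _)
    (by simp; nlinarith) _ (Sum.elim (fun _ => 1) fun _ => 2) fun x hx hort => ?_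
  obtain ⟨z, y, w, rfl⟩ : ∃ z y w, x = Sum.elim (fun _ : Unit => z) (Sum.elim y w) :=
    ⟨x (inl ()), fun a => x (inr (inl a)), fun b => x (inr (inr b)), by
      ext (_ | _ | _) <;> rfl⟩
  rw [dotProduct_distMatrix_Grpq_mulVec]
  simp only [dotProduct, Fintype.sum_sum_type, Sum.elim_inl, Sum.elim_inr, Finset.univ_unique,
    Finset.sum_singleton, ← Finset.mul_sum] at hort ⊢
  set s := ∑ a, y a
  set t := ∑ b, w b
  set Y := ∑ a, y a * y a with hY
  set W := ∑ b, w b * w b with hW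
  have hcl : Y ≤ ∑ i, ((∑ j, y (i, j)) ^ 2 + ∑ j, y (i, j) ^ 2) := by
    rw [hY, Fintype.sum_prod_type]
    refine Finset.sum_le_sum fun i _ => ?_
    simp only [← sq]
    exact le_add_of_nonneg_left (sq_nonneg _)
  have hpaw : (1 / 2 + 1 / 100) * W ≤
      ∑ k, (2 * (w (k, 0) ^ 2 + w (k, 1) ^ 2 + w (k, 2) ^ 2 + w (k, 3) ^ 2)
          + 2 * (w (k, 0) * (w (k, 1) + w (k, 2) + w (k, 3)) + w (k, 2) * w (k, 3))) := by
    rw [hW, Fintype.sum_prod_type, Finset.mul_sum]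
    refine Finset.sum_le_sum fun k _ => ?_
    have := paw_form_lower_bound (w (k, 0)) (w (k, 1)) (w (k, 2)) (w (k, 3))
    simp only [Fin.sum_univ_four]
    linarith
  have hY0 : 0 ≤ Y := Finset.sum_nonneg fun _ _ => mul_self_nonneg _
  have hW0 : 0 ≤ W := Finset.sum_nonneg fun _ _ => mul_self_nonneg _
  have hpos : 0 < Y + W := by
    refine lt_of_le_of_ne (by positivity) fun h0 => hx ?_
    have hy : y = 0 := dotProduct_self_eq_zero.mp (show Y = 0 by linarith)
    have hw : w = 0 := dotProduct_self_eq_zero.mp (show W = 0 by linarith)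
    have hz : z = 0 := by simpa [s, t, hy, hw] using hort
    ext (_ | _ | _) <;> simp [hy, hw, hz]
  have hz : z = -2 * (s + t) := by linarith
  rw [hz]
  nlinarith
end

section
/- Let r ≥ 2 and p, q ≥ 1 be integers and let G = G(r,p,q) = K_1 ⊕ (p K_r ∪ q(K_1 ⊕ (K_1 ∪ K_2))). Then (x+1)^{p(r−1)+q} divides the characteristic polynomial det(x·I − D(G)) in ℝ[x]; equivalently, −1 is an eigenvalue of the distance matrix D(G) with multiplicity at least p(r−1)+q. -/
open Polynomial SimpleGraph Sum

/-- If each row of `M` indexed by `a ∈ S` differs by `c • w a` from a row `f a` with `f a ∉ S`,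
then `c ^ #S` divides the determinant of `M`. -/
theorem pow_card_dvd_det {V R : Type*} [Fintype V] [DecidableEq V] [CommRing R]
    (M : Matrix V V R) (c : R) (S : Finset V) (f : V → V) (w : V → V → R)
    (hf : ∀ a ∈ S, f a ∉ S) (hM : ∀ a ∈ S, M a = c • w a + M (f a)) :
    c ^ S.card ∣ M.det := by
  suffices h : ∀ T ⊆ S, M.det = c ^ T.card *
      Matrix.det (Matrix.of fun v => if v ∈ T then w v else M v) from
    ⟨_, h S subset_rfl⟩
  intro T
  induction T using Finset.induction_on with
  | empty => intro _; simp; rfl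
  | insert a T ha ih =>
    intro hT
    have haS : a ∈ S := hT (Finset.mem_insert_self a T)
    have hTS : T ⊆ S := (Finset.subset_insert a T).trans hT
    have hfa : f a ∉ insert a T := fun h => hf a haS (hT h)
    set N : Matrix V V R := Matrix.of fun v => if v ∈ insert a T then w v else M v with hN
    have hne : a ≠ f a := fun h => hfa (h ▸ Finset.mem_insert_self a T)
    have key : (Matrix.of fun v => if v ∈ T then w v else M v) =
        (N.updateRow a (c • N a)).updateRow a
          ((N.updateRow a (c • N a)) a + (N.updateRow a (c • N a)) (f a)) := by
      ext i j
      by_cases hi : i = a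
      · subst hi
        simp [hN, ha, hne.symm, Matrix.updateRow_apply, hM i haS]
        simp_all
      · simp [hN, hi]
    rw [ih hTS, key, Matrix.det_updateRow_add_self _ hne, Matrix.det_updateRow_smul,
      Matrix.updateRow_eq_self, Finset.card_insert_of_notMem ha, pow_succ, mul_assoc]

theorem dist_map_le {V W : Type*} {G : SimpleGraph V} {H : SimpleGraph W} (φ : G →g H)
    {u v : V} (h : G.Reachable u v) : H.dist (φ u) (φ v) ≤ G.dist u v := by
  obtain ⟨p, hp⟩ := h.exists_walk_length_eq_dist
  rw [← hp, ← p.length_map φ]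
  exact dist_le _

theorem dist_iso_apply {V W : Type*} {G : SimpleGraph V} {H : SimpleGraph W}
    (e : G ≃g H) (u v : V) : H.dist (e u) (e v) = G.dist u v := by
  by_cases h : G.Reachable u v
  · refine le_antisymm (dist_map_le e.toHom h) ?_
    simpa using dist_map_le e.symm.toHom (e.reachable_iff.mpr h)
  · rw [dist_eq_zero_of_not_reachable h,
      dist_eq_zero_of_not_reachable (e.reachable_iff.not.mpr h)]

/-- Twin vertices are at the same distance from every other vertex. -/
theorem dist_eq_of_twins {V : Type*} [DecidableEq V] {G : SimpleGraph V} {u v : V}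
    (h : ∀ w, w ≠ u → w ≠ v → (G.Adj u w ↔ G.Adj v w)) {w : V} (hu : w ≠ u) (hv : w ≠ v) :
    G.dist u w = G.dist v w := by
  let e : G ≃g G :=
    { toEquiv := Equiv.swap u v
      map_rel_iff' := by
        intro a b
        simp only [Equiv.swap_apply_def]
        grind [G.adj_comm, G.irrefl] }
  have := dist_iso_apply e u w
  simpa [e, Equiv.swap_apply_of_ne_of_ne hu hv] using this.symm

/-- For a finset `S` of vertices each of which has an adjacent twin outside `S`,
`(X + 1) ^ #S` divides the characteristic polynomial of the distance matrix. -/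
theorem pow_card_dvd_charpoly_distMatrix {V : Type*} [Fintype V] [DecidableEq V]
    (G : SimpleGraph V) (S : Finset V) (f : V → V) (hf : ∀ a ∈ S, f a ∉ S)
    (hadj : ∀ a ∈ S, G.Adj a (f a))
    (htwin : ∀ a ∈ S, ∀ w, w ≠ a → w ≠ f a → (G.Adj a w ↔ G.Adj (f a) w)) :
    (X + 1 : Polynomial ℝ) ^ S.card ∣ (distMatrix G).charpoly := by
  refine pow_card_dvd_det _ _ S f (fun a => Pi.single a 1 - Pi.single (f a) 1) hf
    fun a ha => funext fun b => ?_
  have hd : G.dist a (f a) = 1 := dist_eq_one_iff_adj.mpr (hadj a ha)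
  have hd' : G.dist (f a) a = 1 := dist_comm.trans hd
  have hne : a ≠ f a := (hadj a ha).ne
  rcases eq_or_ne b a with rfl | hba
  · simp [distMatrix, hd', hne, hne.symm]
  rcases eq_or_ne b (f a) with rfl | hbf
  · simp [distMatrix, hd, hne, hne.symm]
  · simp [distMatrix, hba, hbf, hba.symm, hbf.symm,
      dist_eq_of_twins (htwin a ha) hba hbf]

section Adjacency

variable {α β : Type*} (G : SimpleGraph α) (H : SimpleGraph β)

@[simp]
theorem graphJoin_adj_inl_inr (a : α) (b : β) : (graphJoin G H).Adj (inl a) (inr b) := by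
  simp [graphJoin]

@[simp]
theorem graphJoin_adj_inr_inl (a : α) (b : β) : (graphJoin G H).Adj (inr b) (inl a) :=
  (graphJoin_adj_inl_inr G H a b).symm

@[simp]
theorem graphJoin_adj_inr_inr (a b : β) :
    (graphJoin G H).Adj (inr a) (inr b) ↔ H.Adj a b := by
  simpa [graphJoin, H.adj_comm b a] using H.ne_of_adj

@[simp]
theorem graphSum_adj_inl_inl (a b : α) :
    (graphSum G H).Adj (inl a) (inl b) ↔ G.Adj a b := by
  simpa [graphSum, G.adj_comm b a] using G.ne_of_adj

@[simp]
theorem graphSum_adj_inr_inr (a b : β) :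
    (graphSum G H).Adj (inr a) (inr b) ↔ H.Adj a b := by
  simpa [graphSum, H.adj_comm b a] using H.ne_of_adj

@[simp]
theorem not_graphSum_adj_inl_inr (a : α) (b : β) :
    ¬ (graphSum G H).Adj (inl a) (inr b) := by
  simp [graphSum]

@[simp]
theorem not_graphSum_adj_inr_inl (a : α) (b : β) :
    ¬ (graphSum G H).Adj (inr b) (inl a) := by
  simp [graphSum]

@[simp]
theorem cliqueCopies_adj {p r : ℕ} (x y : Fin p × Fin r) :
    (cliqueCopies p r).Adj x y ↔ x ≠ y ∧ x.1 = y.1 := by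
  simp [cliqueCopies, eq_comm]

@[simp]
theorem pawCopies_adj {q : ℕ} (x y : Fin q × Fin 4) :
    (pawCopies q).Adj x y ↔ x.1 = y.1 ∧ x.2 ≠ y.2 ∧
      (x.2 = 0 ∨ y.2 = 0 ∨ (x.2 = 2 ∧ y.2 = 3) ∨ (x.2 = 3 ∧ y.2 = 2)) := by
  simp only [pawCopies, fromRel_adj, ne_eq, Prod.ext_iff]
  grind

end Adjacency

/-- For `r ≥ 2` and `p, q ≥ 1`, `(x+1)^(p(r-1)+q)` divides the characteristic
polynomial of the distance matrix of `G(r,p,q)`. -/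
theorem stmt_9 (r p q : ℕ) (hr : 2 ≤ r) (hp : 0 < p) (hq : 0 < q) :
    (X + 1 : Polynomial ℝ) ^ (p * (r - 1) + q) ∣ (distMatrix (Grpq r p q)).charpoly := by
  obtain ⟨n, rfl⟩ : ∃ n, r = n + 1 := ⟨r - 1, by omega⟩
  let S : Finset (Unit ⊕ ((Fin p × Fin (n + 1)) ⊕ (Fin q × Fin 4))) :=
    Finset.disjSum ∅ (Finset.disjSum (Finset.univ ×ˢ {0}ᶜ) (Finset.univ ×ˢ {3}))
  let f : Unit ⊕ ((Fin p × Fin (n + 1)) ⊕ (Fin q × Fin 4)) →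
      Unit ⊕ ((Fin p × Fin (n + 1)) ⊕ (Fin q × Fin 4)) :=
    Sum.map id (Sum.map (fun x => (x.1, 0)) (fun x => (x.1, 2)))
  have hS : S.card = p * (n + 1 - 1) + q := by
    simp [S, Finset.card_compl]
  rw [← hS]
  refine pow_card_dvd_charpoly_distMatrix _ S f ?_ ?_ ?_
  · rintro (_ | ⟨i, j⟩ | ⟨i, j⟩) ha <;> simp [S, f]
  · rintro (_ | ⟨i, j⟩ | ⟨i, j⟩) ha <;> simp [S] at ha
    · simpa [f, Grpq] using ha
    · simp [f, Grpq, ← ha]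
  · rintro (_ | ⟨i, j⟩ | ⟨i, j⟩) ha (_ | ⟨k, l⟩ | ⟨k, l⟩) h1 h2 <;> simp [S] at ha <;>
      simp [f, Grpq] at h1 h2 ⊢
    · grind
    · subst ha
      fin_cases l <;> simp_all [eq_comm]
end

section
/- Let q ≥ 2 and r, p ≥ 1 be integers and let G = G(r,p,q) = K_1 ⊕ (p K_r ∪ q(K_1 ⊕ (K_1 ∪ K_2))). Then the polynomial (x^3 + 7x^2 + 13x + 5)^{q−1} divides the characteristic polynomial det(x·I − D(G)) in ℝ[x]. -/
open Polynomial SimpleGraph Sum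

open Matrix in
/-- If a block matrix maps the graph of `U`, the set of all `(U y, y)`, to itself and acts there
as `N`, then the characteristic polynomial of `N` divides that of the block matrix. -/
theorem charpoly_dvd_charpoly_fromBlocks {R m n : Type*} [CommRing R] [Fintype m]
    [DecidableEq m] [Fintype n] [DecidableEq n] (A : Matrix m m R) (B : Matrix m n R)
    (C : Matrix n m R) (D : Matrix n n R) (U : Matrix m n R) (N : Matrix n n R)
    (h₁ : A * U + B = U * N) (h₂ : C * U + D = N) :
    N.charpoly ∣ (fromBlocks A B C D).charpoly := by
  have hinv : fromBlocks 1 U 0 1 * fromBlocks 1 (-U) 0 1 = (1 : Matrix (m ⊕ n) (m ⊕ n) R) := by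
    simp [fromBlocks_multiply]
  have hconj : fromBlocks 1 (-U) 0 1 * fromBlocks A B C D * fromBlocks 1 U 0 1 =
      fromBlocks (A - U * C) 0 C N := by
    rw [Matrix.mul_assoc, fromBlocks_multiply, fromBlocks_multiply]
    simp [h₁, h₂, sub_eq_add_neg]
  have hchar : (fromBlocks 1 (-U) 0 1 * fromBlocks A B C D * fromBlocks 1 U 0 1).charpoly =
      (fromBlocks A B C D).charpoly := by
    rw [charpoly_mul_comm, ← Matrix.mul_assoc, hinv, Matrix.one_mul]
  rw [← hchar, hconj, charpoly_fromBlocks_zero₁₂]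
  exact dvd_mul_left _ _

open Matrix in
theorem charpoly_blockDiagonal_const {R ι β : Type*} [CommRing R] [Fintype ι]
    [DecidableEq ι] [Fintype β] [DecidableEq β] (N : Matrix β β R) :
    (blockDiagonal fun _ : ι => N).charpoly = N.charpoly ^ Fintype.card ι := by
  have h : (blockDiagonal fun _ : ι => N).charmatrix = blockDiagonal fun _ : ι => N.charmatrix := by
    ext ⟨a, i⟩ ⟨b, j⟩
    simp only [charmatrix_apply, blockDiagonal_apply, diagonal_apply, Prod.mk.injEq]
    by_cases hij : i = j <;> simp [hij]
  rw [charpoly, h, det_blockDiagonal]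
  simp [charpoly]

/-- A matrix with interchangeable blocks indexed by `Option ι`, equal to `S + N` on the diagonal
and to `S` off it, has `N.charpoly ^ card ι` dividing its characteristic polynomial. -/
theorem charpoly_pow_dvd_of_interchangeable {R α ι β : Type*} [CommRing R] [Fintype α]
    [DecidableEq α] [Fintype ι] [DecidableEq ι] [Fintype β] [DecidableEq β]
    (A : Matrix (α ⊕ β × Option ι) (α ⊕ β × Option ι) R) (c : α → β → R) (d : β → α → R)
    (S N : Matrix β β R)
    (hc : ∀ a b i, A (inl a) (inr (b, i)) = c a b)
    (hd : ∀ a b i, A (inr (b, i)) (inl a) = d b a)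
    (hA : ∀ b b' i j, A (inr (b, i)) (inr (b', j)) = S b b' + if i = j then N b b' else 0) :
    N.charpoly ^ Fintype.card ι ∣ A.charpoly := by
  let e : α ⊕ β × Option ι ≃ (α ⊕ β) ⊕ β × ι :=
    { toFun := Sum.elim (fun a => inl (inl a))
        fun x => x.2.elim (inl (inr x.1)) fun i => inr (x.1, i)
      invFun := Sum.elim (Sum.elim inl fun b => inr (b, none)) fun x => inr (x.1, some x.2)
      left_inv := by rintro (a | ⟨b, _ | i⟩) <;> rfl
      right_inv := by rintro ((a | b) | ⟨b, i⟩) <;> rfl }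
  rw [← charpoly_blockDiagonal_const, ← Matrix.charpoly_reindex e,
    ← Matrix.fromBlocks_toBlocks (Matrix.reindex e e A)]
  apply charpoly_dvd_charpoly_fromBlocks _ _ _ _
    (Matrix.of (Sum.elim (fun _ _ => 0) fun b x => if b = x.1 then -1 else 0))
  · ext (a | b) ⟨b', i⟩ <;>
      simp [Matrix.mul_apply, Matrix.toBlocks₁₁, Matrix.toBlocks₁₂, e, hc, hA,
        Fintype.sum_prod_type, Matrix.blockDiagonal_apply]
  · ext ⟨b, i⟩ ⟨b', j⟩
    simp [Matrix.mul_apply, Matrix.toBlocks₂₁, Matrix.toBlocks₂₂, e, hd, hA,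
      Matrix.blockDiagonal_apply]

theorem dist_graphJoin_unit {β : Type*} [DecidableEq β] (H : SimpleGraph β)
    [DecidableRel H.Adj] (u v : β) :
    (graphJoin (⊤ : SimpleGraph Unit) H).dist (inr u) (inr v) =
      if u = v then 0 else if H.Adj u v then 1 else 2 := by
  have hadj (w : β) : (graphJoin (⊤ : SimpleGraph Unit) H).Adj (inl ()) (inr w) := by
    simp [graphJoin]
  let w : (graphJoin (⊤ : SimpleGraph Unit) H).Walk (inr u) (inr v) :=
    .cons (hadj u).symm (.cons (hadj v) .nil)
  have hle := dist_le w
  have hiff : (graphJoin (⊤ : SimpleGraph Unit) H).Adj (inr u) (inr v) ↔ H.Adj u v := by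
    simp [graphJoin, H.adj_comm v u]
    exact fun h => h.ne
  split_ifs with h₁ h₂
  · simp [h₁]
  · exact dist_eq_one_iff_adj.mpr (hiff.mpr h₂)
  · have h0 := w.reachable.pos_dist_of_ne (by simpa using h₁)
    have h1 := mt dist_eq_one_iff_adj.mp (mt hiff.mp h₂)
    simp only [w, Walk.length_cons, Walk.length_nil] at hle
    omega

/-- `-2 I` minus the adjacency matrix of the paw graph. -/
def pawBlock : Matrix (Fin 4) (Fin 4) ℝ :=
  !![-2, -1, -1, -1; -1, -2, 0, 0; -1, 0, -2, -1; -1, 0, -1, -2]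

theorem charpoly_pawBlock :
    pawBlock.charpoly = (X ^ 3 + 7 * X ^ 2 + 13 * X + 5) * (X + 1) := by
  simp [Matrix.charpoly, Matrix.charmatrix, pawBlock, Matrix.det_succ_row_zero, Fin.sum_univ_succ,
    Fin.succAbove, show (C 2 : ℝ[X]) = 2 from rfl]
  ring

open Classical in
theorem dist_Grpq_inr (r p q : ℕ) (u v : (Fin p × Fin r) ⊕ (Fin q × Fin 4)) :
    (Grpq r p q).dist (inr u) (inr v) = if u = v then 0 else
      if (graphSum (cliqueCopies p r) (pawCopies q)).Adj u v then 1 else 2 :=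
  dist_graphJoin_unit _ u v

theorem distMatrix_Grpq_paw_s11 (r p q : ℕ) (i j : Fin q) (b b' : Fin 4) :
    distMatrix (Grpq r p q) (inr (inr (i, b))) (inr (inr (j, b'))) =
      2 + if i = j then pawBlock b b' else 0 := by
  by_cases hij : i = j
  · simp only [distMatrix, Matrix.of_apply, dist_Grpq_inr, graphSum, pawCopies, fromRel_adj, hij]
    simp only [inr.injEq, Prod.mk.injEq, true_and]
    fin_cases b <;> fin_cases b' <;> simp +decide [pawBlock] <;> norm_num
  · simp [distMatrix, dist_Grpq_inr, graphSum, pawCopies, hij, Ne.symm hij]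

/-- For `q ≥ 2` and `r, p ≥ 1`, `(x³ + 7x² + 13x + 5)^(q-1)` divides the
characteristic polynomial of the distance matrix of `G(r,p,q)`. -/
theorem stmt_11 (r p q : ℕ) (hq : 2 ≤ q) (hr : 0 < r) (hp : 0 < p) :
    (X ^ 3 + 7 * X ^ 2 + 13 * X + 5 : Polynomial ℝ) ^ (q - 1) ∣
      (distMatrix (Grpq r p q)).charpoly := by
  obtain ⟨k, rfl⟩ : ∃ k, q = k + 1 := ⟨q - 1, by omega⟩
  let e : Unit ⊕ ((Fin p × Fin r) ⊕ (Fin (k + 1) × Fin 4)) ≃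
      (Unit ⊕ (Fin p × Fin r)) ⊕ (Fin 4 × Option (Fin k)) :=
    (Equiv.sumAssoc _ _ _).symm.trans
      (Equiv.sumCongr (Equiv.refl _)
        ((Equiv.prodComm _ _).trans (Equiv.prodCongr (Equiv.refl _) (finSuccEquiv k))))
  have key := charpoly_pow_dvd_of_interchangeable
    (Matrix.reindex e e (distMatrix (Grpq r p (k + 1))))
    (Sum.elim (fun _ _ => 1) fun _ _ => 2) (fun _ => Sum.elim (fun _ => 1) fun _ => 2)
    (Matrix.of fun _ _ => 2) pawBlock ?_ ?_ ?_
  · rw [Matrix.charpoly_reindex, charpoly_pawBlock, mul_pow, Fintype.card_fin] at key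
    exact (dvd_mul_right _ _).trans key
  · rintro (a | a) b i
    · simp [e, distMatrix, Grpq, graphJoin]
    · simp [e, distMatrix, dist_Grpq_inr, graphSum]
  · rintro (a | a) b i
    · simp [e, distMatrix, Grpq, graphJoin]
    · simp [e, distMatrix, dist_Grpq_inr, graphSum]
  · intro b b' i j
    obtain ⟨i, rfl⟩ := (finSuccEquiv k).surjective i
    obtain ⟨j, rfl⟩ := (finSuccEquiv k).surjective j
    simp [e, distMatrix_Grpq_paw_s11]
end

section
/- For all integers r, p, q ≥ 1, the real polynomial f(r,p,q,x) = x^5 − A x^4 − B x^3 − C x^2 − D x − E, where A = 8q + 2rp − r − 8, B = (8r+36)q + 15rp − 7r − 20, C = (28r+52)q + 33rp − 13r − 18, D = (24r+30)q + 23rp − 5r − 5 and E = (6r+6)q + 5rp, satisfies f(r,p,q,x) < 0 for every x in the interval [−1/2, 0], and f(r,p,q,·) has exactly one positive real root counted with multiplicity; consequently f(r,p,q,·) has exactly one real root in [−1/2, ∞), counted with multiplicity. -/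
open Polynomial SimpleGraph Sum

/-- A monic real quintic whose lower coefficients are all negative has exactly one positive root,
counted with multiplicity. -/
theorem card_pos_roots_quintic_eq_one {a b c d e : ℝ} (ha : 0 < a) (hb : 0 < b) (hc : 0 < c)
    (hd : 0 < d) (he : 0 < e) {f : ℝ[X]}
    (hf : f = X ^ 5 - C a * X ^ 4 - C b * X ^ 3 - C c * X ^ 2 - C d * X - C e) :
    (f.roots.filter (fun x => 0 < x)).card = 1 := by
  have hev (x : ℝ) : f.eval x = x ^ 5 - a * x ^ 4 - b * x ^ 3 - c * x ^ 2 - d * x - e := by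
    simp [hf]
  have hder (x : ℝ) : (derivative f).eval x =
      5 * x ^ 4 - a * (4 * x ^ 3) - b * (3 * x ^ 2) - c * (2 * x) - d := by
    simp [hf]
    ring
  have hf0 : f ≠ 0 := by
    rintro rfl
    have := hev 0
    simp at this
    linarith
  have unique {x y : ℝ} (hx : 0 < x) (hxy : x < y) (hfx : f.eval x = 0) : f.eval y ≠ 0 := by
    intro hfy
    have hy := hx.trans hxy
    have h0 : 0 < y - x := sub_pos.2 hxy
    rw [hev] at hfx hfy
    have key : x ^ 5 * (y ^ 5 - a * y ^ 4 - b * y ^ 3 - c * y ^ 2 - d * y - e) -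
        y ^ 5 * (x ^ 5 - a * x ^ 4 - b * x ^ 3 - c * x ^ 2 - d * x - e) =
        (y - x) * (a * x ^ 4 * y ^ 4 + b * x ^ 3 * y ^ 3 * (y + x) +
          c * x ^ 2 * y ^ 2 * (y ^ 2 + y * x + x ^ 2) +
          d * x * y * (y ^ 3 + y ^ 2 * x + y * x ^ 2 + x ^ 3) +
          e * (y ^ 4 + y ^ 3 * x + y ^ 2 * x ^ 2 + y * x ^ 3 + x ^ 4)) := by ring
    rw [hfx, hfy, mul_zero, mul_zero, sub_zero] at key
    exact absurd key (by positivity)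
  obtain ⟨z, hz, hfz⟩ : ∃ z, 0 < z ∧ f.eval z = 0 := by
    set M := 1 + a + b + c + d + e with hM
    have hM1 : 1 ≤ M := by linarith
    have hpos : 0 < f.eval M := by
      have h3 : M ^ 3 ≤ M ^ 4 := pow_le_pow_right₀ hM1 (by norm_num)
      have h2 : M ^ 2 ≤ M ^ 4 := pow_le_pow_right₀ hM1 (by norm_num)
      have h1 : M ≤ M ^ 4 := le_self_pow₀ hM1 (by norm_num)
      have h0 : 1 ≤ M ^ 4 := one_le_pow₀ hM1
      have h5 : M ^ 5 = (1 + a + b + c + d + e) * M ^ 4 := by rw [pow_succ', ← hM]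
      rw [hev, h5]
      linarith [mul_le_mul_of_nonneg_left h3 hb.le, mul_le_mul_of_nonneg_left h2 hc.le,
        mul_le_mul_of_nonneg_left h1 hd.le, mul_le_mul_of_nonneg_left h0 he.le]
    have hneg : f.eval 0 < 0 := by simpa [hev] using he
    obtain ⟨z, hz, hfz⟩ :=
      intermediate_value_Ioo (by linarith : (0 : ℝ) ≤ M) f.continuousOn ⟨hneg, hpos⟩
    exact ⟨z, hz.1, hfz⟩
  have hcount : f.roots.count z = 1 := by
    rw [count_roots]
    refine le_antisymm (not_lt.1 fun h => ?_) ((rootMultiplicity_pos hf0).2 hfz)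
    have hdz : (derivative f).eval z = 0 := ((one_lt_rootMultiplicity_iff_isRoot hf0).1 h).2
    rw [hder] at hdz
    rw [hev] at hfz
    have hpos : 0 < a * z ^ 4 + 2 * b * z ^ 3 + 3 * c * z ^ 2 + 4 * d * z + 5 * e := by positivity
    exact hpos.ne' (by linear_combination z * hdz - 5 * hfz)
  have hfilter : f.roots.filter (fun x => 0 < x) = f.roots.filter (fun x => z = x) := by
    refine Multiset.filter_congr fun x hx => ⟨fun hx0 => ?_, fun h => h ▸ hz⟩
    have hfx : f.eval x = 0 := (mem_roots hf0).1 hx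
    rcases lt_trichotomy z x with h | h | h
    · exact absurd hfx (unique hz h hfz)
    · exact h
    · exact absurd hfz (unique hx0 h hfx)
  rw [hfilter, Multiset.filter_eq, hcount, Multiset.card_replicate]

theorem eval_fpoly (r p q : ℕ) (x : ℝ) :
    (fpoly r p q).eval x =
      (x + 1 + r) * (x * (x ^ 3 + 7 * x ^ 2 + 13 * x + 5) -
        2 * q * ((2 * x + 1) * (2 * x ^ 2 + 6 * x + 3))) -
      r * p * ((2 * x + 1) * (x ^ 3 + 7 * x ^ 2 + 13 * x + 5)) := by
  simp [fpoly]
  ring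

theorem eval_fpoly_neg {r p q : ℕ} (hq : 0 < q) {x : ℝ} (hx : -1/2 ≤ x) (hx0 : x ≤ 0) :
    (fpoly r p q).eval x < 0 := by
  have hq' : (0 : ℝ) < q := Nat.cast_pos.2 hq
  have hc : 0 < x ^ 3 + 7 * x ^ 2 + 13 * x + 5 := by
    have : x ^ 3 + 7 * x ^ 2 + 13 * x + 5 =
        (x + 1 / 2) * ((x + 13 / 4) ^ 2 - 13 / 16) + 1 / 8 := by ring
    nlinarith [mul_nonneg (by linarith : 0 ≤ x + 1 / 2)
      (by nlinarith : 0 ≤ (x + 13 / 4) ^ 2 - 13 / 16)]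
  have hs : 0 < 2 * x ^ 2 + 6 * x + 3 := by nlinarith [sq_nonneg (x + 1 / 2)]
  have h2 : 0 ≤ 2 * x + 1 := by linarith
  have hxr : 0 < x + 1 + r := by linarith [r.cast_nonneg (α := ℝ)]
  have hlt : x * (x ^ 3 + 7 * x ^ 2 + 13 * x + 5) -
      2 * q * ((2 * x + 1) * (2 * x ^ 2 + 6 * x + 3)) < 0 := by
    rcases hx0.lt_or_eq with h | rfl
    · have : 0 ≤ 2 * q * ((2 * x + 1) * (2 * x ^ 2 + 6 * x + 3)) := by positivity
      linarith [mul_neg_of_neg_of_pos h hc]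
    · linarith
  have hrp : 0 ≤ r * p * ((2 * x + 1) * (x ^ 3 + 7 * x ^ 2 + 13 * x + 5)) := by positivity
  rw [eval_fpoly]
  linarith [mul_neg_of_pos_of_neg hxr hlt]

/-- For `r, p, q ≥ 1`: `f(r,p,q,x) < 0` on `[-1/2, 0]`; `f` has exactly one positive
real root (with multiplicity); and consequently exactly one real root in `[-1/2, ∞)`
(with multiplicity). -/
theorem stmt_14 (r p q : ℕ) (hr : 0 < r) (hp : 0 < p) (hq : 0 < q) :
    (∀ x : ℝ, -1/2 ≤ x → x ≤ 0 → (fpoly r p q).eval x < 0) ∧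
    ((fpoly r p q).roots.filter (fun x => 0 < x)).card = 1 ∧
    ((fpoly r p q).roots.filter (fun x => -1/2 ≤ x)).card = 1 := by
  have hneg (x : ℝ) (hx : -1/2 ≤ x) (hx0 : x ≤ 0) : (fpoly r p q).eval x < 0 :=
    eval_fpoly_neg hq hx hx0
  have hr1 : (1 : ℝ) ≤ r := Nat.one_le_cast.2 hr
  have hp1 : (1 : ℝ) ≤ p := Nat.one_le_cast.2 hp
  have hq1 : (1 : ℝ) ≤ q := Nat.one_le_cast.2 hq
  have hrp : (r : ℝ) ≤ r * p := le_mul_of_one_le_right (by linarith) hp1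
  have hrq : (r : ℝ) ≤ r * q := le_mul_of_one_le_right (by linarith) hq1
  have hpos : ((fpoly r p q).roots.filter (fun x => 0 < x)).card = 1 :=
    card_pos_roots_quintic_eq_one (by linarith) (by linarith) (by linarith) (by linarith)
      (by linarith) rfl
  refine ⟨hneg, hpos, ?_⟩
  refine (congrArg Multiset.card ?_).trans hpos
  refine Multiset.filter_congr fun x hx => ⟨fun h => ?_, fun h => by linarith⟩
  by_contra! hx0
  exact (hneg x h hx0).ne (isRoot_of_mem_roots hx)
end

section
/- For every integer r ≥ 2, the triple block graph Pt_2(r,r) has second largest distance eigenvalue λ2(Pt_2(r,r)) < −1/2. -/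
open Polynomial SimpleGraph Sum

theorem SimpleGraph.dist_eq_of_local {V : Type*} (G : SimpleGraph V) (f : V → V → ℕ)
    (h_self : ∀ u, f u u = 0)
    (h_adj : ∀ u v w, G.Adj v w → f u w ≤ f u v + 1)
    (h_pred : ∀ u v, u ≠ v → ∃ w, G.Adj w v ∧ f u w + 1 = f u v) (u v : V) :
    G.dist u v = f u v := by
  have h_walk : ∀ n v, f u v = n → ∃ p : G.Walk u v, p.length = n := by
    intro n
    induction n with
    | zero =>
      intro v hv
      by_cases huv : u = v
      · subst huv
        exact ⟨.nil, rfl⟩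
      · obtain ⟨w, -, hw⟩ := h_pred u v huv
        omega
    | succ n ih =>
      intro v hv
      have huv : u ≠ v := by
        rintro rfl
        simp [h_self] at hv
      obtain ⟨w, hwv, hw⟩ := h_pred u v huv
      obtain ⟨p, hp⟩ := ih w (by omega)
      exact ⟨p.concat hwv, by simp [hp]⟩
  have h_le : ∀ {a b : V} (p : G.Walk a b), f u b ≤ f u a + p.length := by
    intro a b p
    induction p with
    | nil => simp
    | cons h p ih =>
      have := h_adj u _ _ h
      rw [SimpleGraph.Walk.length_cons]
      omega
  obtain ⟨p, hp⟩ := h_walk _ v rfl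
  refine le_antisymm (hp ▸ G.dist_le p) ?_
  obtain ⟨q, hq⟩ := p.reachable.exists_walk_length_eq_dist
  have := h_le q
  rw [h_self, hq] at this
  omega

theorem List.two_le_countP_ge {l : List ℝ} (hl : l.Pairwise (· ≤ ·)) {c : ℝ}
    (h2 : 2 ≤ l.length) (h : c ≤ l.getD (l.length - 2) 0) :
    2 ≤ l.countP (fun x => c ≤ x) := by
  have h_all : ∀ x ∈ l.drop (l.length - 2), c ≤ x := by
    intro x hx
    obtain ⟨i, hi, rfl⟩ := List.mem_iff_getElem.1 hx
    rw [List.getElem_drop]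
    rw [List.getD_eq_getElem _ _ (by omega)] at h
    rw [List.length_drop] at hi
    exact h.trans (hl.rel_get_of_le (a := ⟨l.length - 2, by omega⟩)
      (b := ⟨l.length - 2 + i, by omega⟩) (by simp))
  calc 2 = (l.drop (l.length - 2)).length := by rw [List.length_drop]; omega
    _ = (l.drop (l.length - 2)).countP (fun x => c ≤ x) := by
      symm
      rw [List.countP_eq_length]
      simpa using h_all
    _ ≤ _ := (List.drop_sublist _ _).countP_le

/-- If the quadratic form of `A - c` is negative definite on the kernel of a linear functional,
then the second largest eigenvalue of `A` is smaller than `c`. -/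
theorem Matrix.IsHermitian.second_eigenvalue_lt {V : Type*} [Fintype V] [DecidableEq V]
    {A : Matrix V V ℝ} (hA : A.IsHermitian) (hV : 2 ≤ Fintype.card V) (c : ℝ)
    (φ : (V → ℝ) →ₗ[ℝ] ℝ)
    (h : ∀ x, x ≠ 0 → φ x = 0 → x ⬝ᵥ (A.mulVec x) < c * (x ⬝ᵥ x)) :
    (A.charpoly.roots.sort (· ≤ ·)).getD (Fintype.card V - 2) 0 < c := by
  classical
  by_contra! hc
  have h_roots : A.charpoly.roots = Finset.univ.val.map hA.eigenvalues := by
    simpa using hA.roots_charpoly_eq_eigenvalues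
  have h_len : (A.charpoly.roots.sort (· ≤ ·)).length = Fintype.card V := by
    simp [h_roots]
  have h_count := List.two_le_countP_ge (c := c)
    (Multiset.pairwise_sort A.charpoly.roots (· ≤ ·)) (by omega) (by rwa [h_len])
  rw [← Multiset.coe_countP, Multiset.sort_eq, h_roots, Multiset.countP_map] at h_count
  have h_card : 1 < (Finset.univ.filter fun i => c ≤ hA.eigenvalues i).card := h_count
  obtain ⟨i, hi, j, hj, hij⟩ := Finset.one_lt_card.1 h_card
  simp only [Finset.mem_filter, Finset.mem_univ, true_and] at hi hj
  set v : V → ℝ := (hA.eigenvectorBasis i).ofLp with hv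
  set w : V → ℝ := (hA.eigenvectorBasis j).ofLp with hw
  have h_dot : ∀ k l, (hA.eigenvectorBasis k).ofLp ⬝ᵥ (hA.eigenvectorBasis l).ofLp =
      if k = l then 1 else 0 := by
    intro k l
    have := orthonormal_iff_ite.1 hA.eigenvectorBasis.orthonormal l k
    rw [EuclideanSpace.inner_eq_star_dotProduct] at this
    simpa [eq_comm] using this
  have hvv : v ⬝ᵥ v = 1 := by simp [hv, h_dot]
  have hww : w ⬝ᵥ w = 1 := by simp [hw, h_dot]
  have hvw : v ⬝ᵥ w = 0 := by simp [hv, hw, h_dot, hij]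
  have hwv : w ⬝ᵥ v = 0 := by rw [dotProduct_comm, hvw]
  have hAv : A.mulVec v = hA.eigenvalues i • v := hA.mulVec_eigenvectorBasis i
  have hAw : A.mulVec w = hA.eigenvalues j • w := hA.mulVec_eigenvectorBasis j
  obtain ⟨α, β, hαβ, hφ⟩ : ∃ α β : ℝ, 0 < α ^ 2 + β ^ 2 ∧ α * φ v + β * φ w = 0 := by
    by_cases h0 : φ v = 0
    · exact ⟨1, 0, by norm_num, by simp [h0]⟩
    · exact ⟨φ w, -φ v, by have := sq_pos_of_ne_zero h0; nlinarith [sq_nonneg (φ w)], by ring⟩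
  have h_norm : (α • v + β • w) ⬝ᵥ (α • v + β • w) = α ^ 2 + β ^ 2 := by
    simp only [add_dotProduct, dotProduct_add, smul_dotProduct, dotProduct_smul, smul_eq_mul,
      hvv, hww, hvw, hwv]
    ring
  have h_form : (α • v + β • w) ⬝ᵥ A.mulVec (α • v + β • w) =
      α ^ 2 * hA.eigenvalues i + β ^ 2 * hA.eigenvalues j := by
    simp only [Matrix.mulVec_add, Matrix.mulVec_smul, hAv, hAw, add_dotProduct, dotProduct_add,
      smul_dotProduct, dotProduct_smul, smul_eq_mul, hvv, hww, hvw, hwv]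
    ring
  have h_lt := h (α • v + β • w) (by
    intro h0
    rw [h0] at h_norm
    simp at h_norm
    linarith) (by simpa using hφ)
  rw [h_norm, h_form] at h_lt
  nlinarith [mul_le_mul_of_nonneg_left hi (sq_nonneg α),
    mul_le_mul_of_nonneg_left hj (sq_nonneg β)]

/-- The type of a vertex of `Pt2Graph`: the five vertices of the full house are of distinct types,
and each of the two added cliques forms one further type. -/
def pt2Type {m n : ℕ} : Fin 5 ⊕ (Fin m ⊕ Fin n) → Fin 7
  | Sum.inl i => i.castLE (by norm_num)
  | Sum.inr (Sum.inl _) => 5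
  | Sum.inr (Sum.inr _) => 6

/-- The distance in `Pt2Graph` between distinct vertices of given types
(with value `1` on the diagonal). -/
def pt2TypeDist : Fin 7 → Fin 7 → ℕ :=
  !![1, 1, 1, 1, 1, 1, 2;
     1, 1, 1, 1, 1, 2, 1;
     1, 1, 1, 2, 2, 2, 2;
     1, 1, 2, 1, 1, 2, 2;
     1, 1, 2, 1, 1, 2, 2;
     1, 2, 2, 2, 2, 1, 3;
     2, 1, 2, 2, 2, 3, 1]

theorem Pt2Graph_adj_iff {p q : ℕ} (u v : Fin 5 ⊕ (Fin (p - 1) ⊕ Fin (q - 1))) :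
    (Pt2Graph p q).Adj u v ↔ u ≠ v ∧ pt2TypeDist (pt2Type u) (pt2Type v) = 1 := by
  rw [Pt2Graph, SimpleGraph.fromRel_adj]
  refine and_congr_right fun huv => ?_
  rcases u with i | i | i <;> rcases v with j | j | j
  · have : i ≠ j := fun h => huv (congrArg _ h)
    clear huv
    revert i j
    simp only [pt2Type]
    decide
  all_goals clear huv
  · revert i
    simp only [pt2Type]
    decide
  · revert i
    simp only [pt2Type]
    decide
  · revert j
    simp only [pt2Type]
    decide
  · simp [pt2Type, pt2TypeDist]
  · simp [pt2Type, pt2TypeDist]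
  · revert j
    simp only [pt2Type]
    decide
  · simp [pt2Type, pt2TypeDist]
  · simp [pt2Type, pt2TypeDist]

theorem Pt2Graph_dist {p q : ℕ} (u v : Fin 5 ⊕ (Fin (p - 1) ⊕ Fin (q - 1))) :
    (Pt2Graph p q).dist u v =
      if u = v then 0 else pt2TypeDist (pt2Type u) (pt2Type v) := by
  refine SimpleGraph.dist_eq_of_local (Pt2Graph p q)
    (fun u v => if u = v then 0 else pt2TypeDist (pt2Type u) (pt2Type v)) (by simp) ?_ ?_ u v
  · intro u v w hvw
    rw [Pt2Graph_adj_iff] at hvw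
    have h_tri : ∀ i j k : Fin 7, pt2TypeDist j k = 1 → pt2TypeDist i k ≤ pt2TypeDist i j + 1 := by
      decide
    by_cases huv : u = v
    · subst huv
      simp [hvw]
    · simp only [huv, if_false]
      split_ifs
      · simp
      · exact h_tri _ _ _ hvw.2
  · intro u v huv
    by_cases h1 : pt2TypeDist (pt2Type u) (pt2Type v) = 1
    · exact ⟨u, (Pt2Graph_adj_iff u v).2 ⟨huv, h1⟩, by simp [huv, h1]⟩
    · have h_hub : ∀ i j : Fin 7, pt2TypeDist i j ≠ 1 → ∃ k : Fin 2,
          (k.castLE (by norm_num) : Fin 7) ≠ i ∧ (k.castLE (by norm_num) : Fin 7) ≠ j ∧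
          pt2TypeDist (k.castLE (by norm_num)) j = 1 ∧
          pt2TypeDist i (k.castLE (by norm_num)) + 1 = pt2TypeDist i j := by
        decide
      obtain ⟨k, hki, hkj, hadj, hdist⟩ := h_hub _ _ h1
      have hku : u ≠ Sum.inl (k.castLE (by norm_num)) := by
        rintro rfl
        exact hki rfl
      have hkv : Sum.inl (k.castLE (by norm_num)) ≠ v := by
        rintro rfl
        exact hkj rfl
      refine ⟨Sum.inl (k.castLE (by norm_num)), (Pt2Graph_adj_iff _ _).2 ⟨hkv, hadj⟩, ?_⟩
      simp only [huv, hku, if_false]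
      exact hdist

theorem sum_pt2Type_mul {m n : ℕ} (g : Fin 7 → ℝ) (x : Fin 5 ⊕ (Fin m ⊕ Fin n) → ℝ) :
    ∑ v, g (pt2Type v) * x v =
      g 0 * x (Sum.inl 0) + g 1 * x (Sum.inl 1) + g 2 * x (Sum.inl 2) + g 3 * x (Sum.inl 3) +
        g 4 * x (Sum.inl 4) + g 5 * ∑ i, x (Sum.inr (Sum.inl i)) +
        g 6 * ∑ i, x (Sum.inr (Sum.inr i)) := by
  simp only [Fintype.sum_sum_type, Fin.sum_univ_five, Finset.mul_sum, pt2Type]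
  rw [add_assoc _ (∑ i, _) (∑ i, _)]
  rfl

theorem Pt2Graph_distMatrix_form {p q : ℕ} (x : Fin 5 ⊕ (Fin (p - 1) ⊕ Fin (q - 1)) → ℝ) :
    x ⬝ᵥ ((distMatrix (Pt2Graph p q)).mulVec x) =
      ∑ u, (∑ v, (pt2TypeDist (pt2Type u) (pt2Type v) : ℝ) * x v) * x u - x ⬝ᵥ x := by
  simp only [dotProduct, Matrix.mulVec, ← Finset.sum_sub_distrib]
  refine Finset.sum_congr rfl fun u _ => ?_
  have h_diag : ∀ i, pt2TypeDist i i = 1 := by decide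
  have h_entry : ∀ v, distMatrix (Pt2Graph p q) u v * x v =
      (pt2TypeDist (pt2Type u) (pt2Type v) : ℝ) * x v - if u = v then x v else 0 := by
    intro v
    by_cases huv : u = v
    · subst huv
      simp [distMatrix, h_diag]
    · simp [distMatrix, Pt2Graph_dist, huv]
  simp only [h_entry, Finset.sum_sub_distrib, Finset.sum_ite_eq, Finset.mem_univ, if_true]
  ring

/-- The linear functional on whose kernel the form of the distance matrix plus `1/2` is
negative definite. -/
def pt2Functional (m n : ℕ) : (Fin 5 ⊕ (Fin m ⊕ Fin n) → ℝ) →ₗ[ℝ] ℝ :=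
  ∑ v, (![3, 3, 4, 4, 4, 6, 6] (pt2Type v) : ℝ) • LinearMap.proj v

theorem Pt2Graph_form_lt {p q : ℕ} (x : Fin 5 ⊕ (Fin (p - 1) ⊕ Fin (q - 1)) → ℝ) (hx : x ≠ 0)
    (hφ : pt2Functional (p - 1) (q - 1) x = 0) :
    x ⬝ᵥ ((distMatrix (Pt2Graph p q)).mulVec x) < -1/2 * (x ⬝ᵥ x) := by
  by_contra! hge
  apply hx
  have hL : ∑ v, (![3, 3, 4, 4, 4, 6, 6] (pt2Type v) : ℝ) * x v = 0 := by
    simpa [pt2Functional] using hφ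
  rw [sum_pt2Type_mul] at hL
  rw [Pt2Graph_distMatrix_form] at hge
  have h_row : ∀ i, ∑ v, (pt2TypeDist i (pt2Type v) : ℝ) * x v = _ :=
    fun i => sum_pt2Type_mul (fun j => (pt2TypeDist i j : ℝ)) x
  simp only [h_row] at hge
  rw [sum_pt2Type_mul fun i => (pt2TypeDist i 0 : ℝ) * x (Sum.inl 0) +
    (pt2TypeDist i 1 : ℝ) * x (Sum.inl 1) + (pt2TypeDist i 2 : ℝ) * x (Sum.inl 2) +
    (pt2TypeDist i 3 : ℝ) * x (Sum.inl 3) + (pt2TypeDist i 4 : ℝ) * x (Sum.inl 4) +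
    (pt2TypeDist i 5 : ℝ) * ∑ k, x (Sum.inr (Sum.inl k)) +
    (pt2TypeDist i 6 : ℝ) * ∑ k, x (Sum.inr (Sum.inr k))] at hge
  have h_norm : x ⬝ᵥ x = x (Sum.inl 0) ^ 2 + x (Sum.inl 1) ^ 2 + x (Sum.inl 2) ^ 2 +
      x (Sum.inl 3) ^ 2 + x (Sum.inl 4) ^ 2 + ∑ i, x (Sum.inr (Sum.inl i)) ^ 2 +
      ∑ i, x (Sum.inr (Sum.inr i)) ^ 2 := by
    simp only [dotProduct, Fintype.sum_sum_type, Fin.sum_univ_five, ← sq]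
    ring
  rw [h_norm] at hge
  have hS : 0 ≤ ∑ i, x (Sum.inr (Sum.inl i)) ^ 2 := Finset.sum_nonneg fun i _ => sq_nonneg _
  have hT : 0 ≤ ∑ i, x (Sum.inr (Sum.inr i)) ^ 2 := Finset.sum_nonneg fun i _ => sq_nonneg _
  have hS0 : ∑ i, x (Sum.inr (Sum.inl i)) ^ 2 = 0 → ∀ i, x (Sum.inr (Sum.inl i)) = 0 := by
    intro h i
    rw [Finset.sum_eq_zero_iff_of_nonneg fun i _ => sq_nonneg _] at h
    exact pow_eq_zero_iff two_ne_zero |>.1 (h i (Finset.mem_univ i))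
  have hT0 : ∑ i, x (Sum.inr (Sum.inr i)) ^ 2 = 0 → ∀ i, x (Sum.inr (Sum.inr i)) = 0 := by
    intro h i
    rw [Finset.sum_eq_zero_iff_of_nonneg fun i _ => sq_nonneg _] at h
    exact pow_eq_zero_iff two_ne_zero |>.1 (h i (Finset.mem_univ i))
  generalize ∑ i, x (Sum.inr (Sum.inl i)) ^ 2 = S at *
  generalize ∑ i, x (Sum.inr (Sum.inr i)) ^ 2 = T at *
  generalize hs : ∑ i, x (Sum.inr (Sum.inl i)) = s at hge hL
  generalize ht : ∑ i, x (Sum.inr (Sum.inr i)) = t at hge hL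
  simp [pt2TypeDist] at hge hL
  generalize hx0 : x (Sum.inl 0) = x0 at hge hL
  generalize hx1 : x (Sum.inl 1) = x1 at hge hL
  generalize hx2 : x (Sum.inl 2) = x2 at hge hL
  generalize hx3 : x (Sum.inl 3) = x3 at hge hL
  generalize hx4 : x (Sum.inl 4) = x4 at hge hL
  have h_sos : S / 2 + T / 2 + (s + t) ^ 2 + ((x0 - x1) / 2 + (s - t)) ^ 2 + ((x3 - x4) / 2) ^ 2 +
      5 / 6 * (x2 - 4 / 5 * (x3 + x4)) ^ 2 + 1 / 20 * (x3 + x4) ^ 2 ≤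
      1 / 12 * (3 * x0 + 3 * x1 + 4 * x2 + 4 * x3 + 4 * x4 + 6 * s + 6 * t) ^ 2 := by
    linarith
  rw [hL] at h_sos
  have h1 := sq_nonneg (s + t)
  have h2 := sq_nonneg ((x0 - x1) / 2 + (s - t))
  have h3 := sq_nonneg ((x3 - x4) / 2)
  have h4 := sq_nonneg (x2 - 4 / 5 * (x3 + x4))
  have h5 := sq_nonneg (x3 + x4)
  have hS' := hS0 (by linarith)
  have hT' := hT0 (by linarith)
  have hs0 : s = 0 := by simp [← hs, hS']
  have ht0 : t = 0 := by simp [← ht, hT']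
  have e2 : (x0 - x1) / 2 + (s - t) = 0 := pow_eq_zero_iff two_ne_zero |>.1 (by linarith)
  have e3 : (x3 - x4) / 2 = 0 := pow_eq_zero_iff two_ne_zero |>.1 (by linarith)
  have e4 : x2 - 4 / 5 * (x3 + x4) = 0 := pow_eq_zero_iff two_ne_zero |>.1 (by linarith)
  have e5 : x3 + x4 = 0 := pow_eq_zero_iff two_ne_zero |>.1 (by linarith)
  funext v
  rcases v with i | i | i
  · fin_cases i
    · exact hx0.trans (show x0 = 0 by linarith)
    · exact hx1.trans (show x1 = 0 by linarith)
    · exact hx2.trans (show x2 = 0 by linarith)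
    · exact hx3.trans (show x3 = 0 by linarith)
    · exact hx4.trans (show x4 = 0 by linarith)
  · exact hS' i
  · exact hT' i

/-- For every integer `r ≥ 2`, the triple block graph `Pt_2(r,r)` satisfies
`λ₂ < -1/2`. -/
theorem stmt_16 (r : ℕ) (hr : 2 ≤ r) :
    lambda2 (Pt2Graph r r) < -1/2 := by
  refine (distMatrix_isHermitian _).second_eigenvalue_lt ?_ _ (pt2Functional (r - 1) (r - 1))
    fun x => Pt2Graph_form_lt x
  simp
  omega
end
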